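/- Let H₁ and H₂ be nontrivial subgroups of F and let H = H₁ ∩ H₂. For every i such that rk_{H₁}(i) ≥ 1 and rk_{H₂}(i) ≥ 1 one has rk_H(i) ≤ 1 + 2·(rk_{H₁}(i) − 1)·(rk_{H₂}(i) − 1) − min(rk_{H₁}(i) − 1, rk_{H₂}(i) − 1). Consequently rk_H ≼ rk_{H₁} · rk_{H₂}. -/

import Mathlib

open FreeGroup

/-- `B` is a free basis of the subgroup `H`: `B ⊆ H` and the induced homomorphism
from the free group on `B` to `H` is an isomorphism. -/
def IsFreeBasis {G : Type*} [Group G] (H : Subgroup G) (B : Set G) : Prop :=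
  ∃ hB : ∀ b ∈ B, b ∈ H,
    Function.Bijective (FreeGroup.lift (fun b : B => (⟨(b : G), hB b b.2⟩ : H)))

/-- `rk` is the rank-growth function of `H`: `rk i` is the rank (the size of a
finite free basis) of the subgroup `H_i` generated by the elements of `H` of
length at most `i`. -/
def IsRankGrowth {n : ℕ} (H : Subgroup (FreeGroup (Fin n))) (rk : ℕ → ℕ) : Prop :=
  ∀ i, ∃ B : Set (FreeGroup (Fin n)), B.Finite ∧ B.ncard = rk i ∧
    IsFreeBasis (Subgroup.closure {h : FreeGroup (Fin n) | h ∈ H ∧ FreeGroup.norm h ≤ i}) B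

/-- `f ≼ g` for growth functions: `f i ≤ c · g (c·i)` for some constant `c ≥ 1`. -/
def GrowthLe (f g : ℕ → ℚ) : Prop :=
  ∃ c : ℕ, 1 ≤ c ∧ ∀ i, f i ≤ (c : ℚ) * g (c * i)

namespace RG

/-! ### A left-invariant order on the free group -/

def enc {n : ℕ} (p : Fin n × Bool) : ℕ := 2 * p.1.val + (if p.2 then 1 else 0)

def bar {n : ℕ} (p : Fin n × Bool) : Fin n × Bool := (p.1, !p.2)

def sg {n : ℕ} (p : Fin n × Bool) : ℤ := if p.2 then 1 else -1

def cmpS {n : ℕ} (p q : Fin n × Bool) : ℤ :=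
  if enc p < enc q then 1 else if enc q < enc p then -1 else 0

def junc {n : ℕ} : List (Fin n × Bool) → List (Fin n × Bool) → ℤ
  | u, v => match u.getLast?, v.head? with
    | some p, some q => cmpS (bar p) q
    | _, _ => 0

def tau {n : ℕ} : List (Fin n × Bool) → ℤ
  | [] => 0
  | p :: L => sg p + junc [p] L + tau L

lemma enc_inj {n : ℕ} {p q : Fin n × Bool} (h : enc p = enc q) : p = q := by
  obtain ⟨p, b⟩ := p
  obtain ⟨q, c⟩ := q
  unfold enc at h
  have : p.val = q.val ∧ b = c := by
    cases b <;> cases c <;> simp at h ⊢ <;> omega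
  ext <;> simp [this.1, this.2]

lemma bar_bar {n : ℕ} (p : Fin n × Bool) : bar (bar p) = p := by
  simp [bar]

lemma sg_bar {n : ℕ} (p : Fin n × Bool) : sg (bar p) = - sg p := by
  obtain ⟨p, b⟩ := p
  cases b <;> simp [bar, sg]

lemma cmpS_symm {n : ℕ} (p q : Fin n × Bool) : cmpS p q = - cmpS q p := by
  unfold cmpS
  split_ifs <;> omega

lemma tau_append {n : ℕ} (u v : List (Fin n × Bool)) :
    tau (u ++ v) = tau u + tau v + junc u v := by
  induction u with
  | nil => simp [tau, junc]
  | cons p L ih =>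
    simp only [List.cons_append, tau, ih]
    cases L with
    | nil => simp [junc, tau]; ring
    | cons q L => simp [junc]; ring

def winv {n : ℕ} (L : List (Fin n × Bool)) : List (Fin n × Bool) := (L.map bar).reverse

lemma tau_winv {n : ℕ} (L : List (Fin n × Bool)) : tau (winv L) = - tau L := by
  induction L with
  | nil => simp [winv, tau]
  | cons p L ih =>
    have : winv (p :: L) = winv L ++ [bar p] := by simp [winv]
    rw [this, tau_append, ih]
    have h2 : junc (winv L) [bar p] = - junc [p] L := by
      cases L with
      | nil => simp [winv, junc]
      | cons q L =>
        simp [winv, junc, bar_bar]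
        exact cmpS_symm _ _
    rw [h2]
    simp [tau, junc, sg_bar]
    ring

lemma winv_eq {n : ℕ} (L : List (Fin n × Bool)) : winv L = FreeGroup.invRev L := by
  simp [winv, FreeGroup.invRev, bar]

lemma isReduced_split {n : ℕ} (L : List (Fin n × Bool)) :
    ∀ M : List (Fin n × Bool), IsReduced L → IsReduced M →
    ∃ u c v, L = u ++ c ∧ M = winv c ++ v ∧ IsReduced (u ++ v) := by
  induction L using List.reverseRecOn with
  | nil => intro M hL hM; exact ⟨[], [], M, by simp, by simp [winv], by simpa using hM⟩
  | append_singleton L p ih =>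
    intro M hL hM
    cases M with
    | nil => exact ⟨L ++ [p], [], [], by simp, by simp [winv], by simpa using hL⟩
    | cons q M =>
      by_cases h : q = bar p
      · obtain ⟨u, c, v, h1, h2, h3⟩ := ih M (List.IsChain.left_of_append hL)
          (List.IsChain.tail hM)
        refine ⟨u, c ++ [p], v, by simp [h1], ?_, h3⟩
        simp [winv, h, h2]
      · refine ⟨L ++ [p], [], q :: M, by simp, by simp [winv], ?_⟩
        unfold FreeGroup.IsReduced at *
        rw [List.isChain_append]
        refine ⟨hL, hM, ?_⟩
        intro x hx y hy
        simp at hx hy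
        subst hx; subst hy
        intro h1
        by_contra h2
        apply h
        ext
        · simp [bar, h1]
        · simp [bar]; revert h2; cases p.2 <;> cases q.2 <;> simp

lemma junc_bound {n : ℕ} (u c v : List (Fin n × Bool)) :
    |junc u c + junc (winv c) v - junc u v| ≤ 1 := by
  have key : ∀ p q r : Fin n × Bool, |cmpS p q + cmpS q r - cmpS p r| ≤ 1 := by
    intro p q r
    rw [abs_le]
    unfold cmpS
    split_ifs <;> omega
  have key2 : ∀ p q : Fin n × Bool, |cmpS p q| ≤ 1 := by
    intro p q
    rw [abs_le]
    unfold cmpS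
    split_ifs <;> omega
  cases c with
  | nil =>
    simp only [winv, junc]
    rcases u.getLast? with _ | p <;> rcases v.head? with _ | r <;> simp <;> apply key2
  | cons q c =>
    simp only [winv, junc]
    rcases u.getLast? with _ | p <;> rcases v.head? with _ | r <;> simp [bar_bar]
    · apply key2
    · apply key2
    · apply key

def tauF {n : ℕ} (g : FreeGroup (Fin n)) : ℤ := tau g.toWord

lemma tauF_inv {n : ℕ} (g : FreeGroup (Fin n)) : tauF g⁻¹ = - tauF g := by
  unfold tauF
  rw [FreeGroup.toWord_inv, ← winv_eq, tau_winv]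

lemma tauF_mul {n : ℕ} (g h : FreeGroup (Fin n)) : tauF g + tauF h - 1 ≤ tauF (g * h) := by
  obtain ⟨u, c, v, h1, h2, h3⟩ := isReduced_split g.toWord h.toWord isReduced_toWord isReduced_toWord
  have h4 : (g * h).toWord = u ++ v := by
    have : g * h = FreeGroup.mk (u ++ v) := by
      rw [← FreeGroup.mk_toWord (x := g), ← FreeGroup.mk_toWord (x := h), h1, h2, winv_eq,
        ← FreeGroup.mul_mk, ← FreeGroup.mul_mk, ← FreeGroup.mul_mk, ← FreeGroup.inv_mk]
      group
    rw [this, FreeGroup.toWord_mk, h3.reduce_eq]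
  unfold tauF
  rw [h4, h1, h2, tau_append, tau_append, tau_append, tau_winv]
  have := junc_bound u c v
  rw [abs_le] at this
  omega

lemma tau_odd {n : ℕ} (L : List (Fin n × Bool)) (h : IsReduced L) (hL : L ≠ []) :
    tau L % 2 = 1 := by
  induction L with
  | nil => simp at hL
  | cons p L ih =>
    have hs : sg p % 2 = 1 := by unfold sg; split_ifs <;> rfl
    cases L with
    | nil => simpa [tau, junc] using hs
    | cons q L =>
      have ih' := ih (List.IsChain.tail h) (by simp)
      have hj : junc [p] (q :: L) % 2 = 1 := by
        simp only [junc, List.getLast?_singleton, List.head?_cons]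
        have hne : enc (bar p) ≠ enc q := by
          intro h'
          have h' := enc_inj h'
          unfold FreeGroup.IsReduced at h
          rw [List.isChain_cons_cons] at h
          have := h.1 (by rw [← h']; rfl)
          rw [← h'] at this
          simp [bar] at this
        unfold cmpS
        split_ifs <;> omega
      rw [tau]
      omega

lemma tauF_ne {n : ℕ} (g : FreeGroup (Fin n)) (h : g ≠ 1) : tauF g ≠ 0 := by
  have := tau_odd g.toWord isReduced_toWord (by simpa using h)
  unfold tauF
  omega

abbrev Ed (n : ℕ) := FreeGroup (Fin n) × Fin n

def act {n : ℕ} (g : FreeGroup (Fin n)) (e : Ed n) : Ed n := (g * e.1, e.2)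

def edLt {n : ℕ} (e f : Ed n) : Prop := 0 < tauF (e.1⁻¹ * f.1) ∨ (e.1 = f.1 ∧ e.2 < f.2)

lemma tauF_one {n : ℕ} : tauF (1 : FreeGroup (Fin n)) = 0 := by simp [tauF, tau]

lemma edLt_trans {n : ℕ} (e f g : Ed n) (h1 : edLt e f) (h2 : edLt f g) : edLt e g := by
  rcases h1 with h1 | h1 <;> rcases h2 with h2 | h2
  · left
    have := tauF_mul (e.1⁻¹ * f.1) (f.1⁻¹ * g.1)
    rw [show e.1⁻¹ * f.1 * (f.1⁻¹ * g.1) = e.1⁻¹ * g.1 by group] at this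
    omega
  · left; rwa [← h2.1]
  · left; rwa [h1.1]
  · right; exact ⟨h1.1.trans h2.1, h1.2.trans h2.2⟩

lemma edLt_irrefl {n : ℕ} (e : Ed n) : ¬ edLt e e := by
  rintro (h | h)
  · simp [tauF_one] at h
  · exact absurd h.2 (lt_irrefl _)

lemma edLt_total {n : ℕ} (e f : Ed n) : edLt e f ∨ e = f ∨ edLt f e := by
  by_cases h : e.1 = f.1
  · rcases lt_trichotomy e.2 f.2 with h2 | h2 | h2
    · left; right; exact ⟨h, h2⟩
    · right; left; exact Prod.ext h h2
    · right; right; right; exact ⟨h.symm, h2⟩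
  · have h1 : tauF (e.1⁻¹ * f.1) ≠ 0 := tauF_ne _ (by
      intro h'; exact h (inv_mul_eq_one.mp h'))
    rcases lt_or_gt_of_ne h1 with h2 | h2
    · right; right; left
      rw [show f.1⁻¹ * e.1 = (e.1⁻¹ * f.1)⁻¹ by group, tauF_inv]; omega
    · left; left; exact h2

lemma edLt_act {n : ℕ} (g : FreeGroup (Fin n)) (e f : Ed n) (h : edLt e f) :
    edLt (act g e) (act g f) := by
  rcases h with h | h
  · left
    simp only [act]
    rwa [show (g * e.1)⁻¹ * (g * f.1) = e.1⁻¹ * f.1 by group]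
  · right; simp [act, h]

lemma exists_order (n : ℕ) : ∃ o : LinearOrder (Ed n), ∀ (g : FreeGroup (Fin n)) (e f : Ed n),
    o.lt e f → o.lt (act g e) (act g f) := by
  classical
  have : IsStrictTotalOrder (Ed n) edLt :=
    { trichotomous := fun a b h1 h2 => by
        rcases edLt_total a b with h | h | h
        · exact absurd h h1
        · exact h
        · exact absurd h h2
      irrefl := edLt_irrefl
      trans := edLt_trans }
  refine ⟨linearOrderOfSTO edLt, fun g e f h => edLt_act g e f h⟩

end RG

namespace RG

section graph
variable {n : ℕ}

/-! ### Graphs in the Cayley tree -/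

def tgt (e : Ed n) : FreeGroup (Fin n) := e.1 * FreeGroup.of e.2

def Step (S : Set (Ed n)) (u v : FreeGroup (Fin n)) : Prop :=
  ∃ e ∈ S, (u = e.1 ∧ v = tgt e) ∨ (v = e.1 ∧ u = tgt e)

def Conn (S : Set (Ed n)) (u v : FreeGroup (Fin n)) : Prop := Relation.ReflTransGen (Step S) u v

lemma Conn.refl (S : Set (Ed n)) (u : FreeGroup (Fin n)) : Conn S u u := Relation.ReflTransGen.refl

lemma Conn.symm {S : Set (Ed n)} {u v : FreeGroup (Fin n)} (h : Conn S u v) : Conn S v u := by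
  unfold Conn at *
  induction h with
  | refl => exact Relation.ReflTransGen.refl
  | tail _ h ih =>
    refine Relation.ReflTransGen.head ?_ ih
    obtain ⟨e, he, h⟩ := h
    exact ⟨e, he, h.symm⟩

lemma Conn.trans {S : Set (Ed n)} {u v w : FreeGroup (Fin n)} (h : Conn S u v) (h' : Conn S v w) :
    Conn S u w := Relation.ReflTransGen.trans h h'

lemma Conn.mono {S S' : Set (Ed n)} (hS : S ⊆ S') {u v : FreeGroup (Fin n)} (h : Conn S u v) :
    Conn S' u v :=
  Relation.ReflTransGen.mono (fun _ _ ⟨e, he, h⟩ => ⟨e, hS he, h⟩) _ _ h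

lemma conn_edge {S : Set (Ed n)} {e : Ed n} (h : e ∈ S) : Conn S e.1 (tgt e) :=
  Relation.ReflTransGen.single ⟨e, h, Or.inl ⟨rfl, rfl⟩⟩

/-- A function which does not change along edges of `S` is constant on components. -/
lemma Conn.const {S : Set (Ed n)} {β : Type*} (f : FreeGroup (Fin n) → β)
    (hf : ∀ e ∈ S, f e.1 = f (tgt e)) {u v : FreeGroup (Fin n)} (h : Conn S u v) : f u = f v := by
  unfold Conn at h
  induction h with
  | refl => rfl
  | tail _ h ih =>
    obtain ⟨e, he, h | h⟩ := h
    · rw [ih, h.1, h.2, hf e he]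
    · rw [ih, h.1, h.2, hf e he]

lemma Conn.act {S : Set (Ed n)} {S' : Set (Ed n)} (g : FreeGroup (Fin n))
    (hS : ∀ e ∈ S, act g e ∈ S') {u v : FreeGroup (Fin n)}
    (h : Conn S u v) : Conn S' (g * u) (g * v) := by
  unfold Conn at *
  induction h with
  | refl => exact Relation.ReflTransGen.refl
  | tail _ h ih =>
    refine Relation.ReflTransGen.tail ih ?_
    obtain ⟨e, he, h⟩ := h
    refine ⟨_, hS e he, ?_⟩
    simp only [RG.act, tgt] at *
    rcases h with h | h
    · left; rw [h.1, h.2]; simp [mul_assoc]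
    · right; rw [h.1, h.2]; simp [mul_assoc]

def stepPerm {K : Type*} [AddCommGroup K] (c : Ed n → K) (x : Fin n) :
    Equiv.Perm (FreeGroup (Fin n) × K) where
  toFun p := (p.1 * FreeGroup.of x, p.2 + c (p.1, x))
  invFun p := (p.1 * (FreeGroup.of x)⁻¹, p.2 - c (p.1 * (FreeGroup.of x)⁻¹, x))
  left_inv p := by ext <;> simp
  right_inv p := by ext <;> simp

/-- Integration of cochains on the Cayley tree. -/
lemma integrate {K : Type*} [AddCommGroup K] (c : Ed n → K) :
    ∃ f : FreeGroup (Fin n) → K, f 1 = 0 ∧ ∀ e : Ed n, f (tgt e) = f e.1 + c e := by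
  let θ : FreeGroup (Fin n) →* Equiv.Perm (FreeGroup (Fin n) × K) :=
    FreeGroup.lift (fun x => (stepPerm c x)⁻¹)
  have h1 : ∀ g : FreeGroup (Fin n), ∀ q, ((θ g)⁻¹ q).1 = q.1 * g := by
    intro g
    induction g using FreeGroup.induction_on with
    | C1 => intro q; simp
    | of x => intro q; simp [θ, stepPerm]
    | inv_of x h =>
      intro q
      have := h ((θ (FreeGroup.of x)) q)
      have h' : (θ (FreeGroup.of x))⁻¹ ((θ (FreeGroup.of x)) q) = q := by
        rw [← Equiv.Perm.mul_apply]; simp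
      rw [h'] at this
      rw [_root_.map_inv, inv_inv, this]
      group
    | mul g h hg hh =>
      intro q
      rw [_root_.map_mul, mul_inv_rev, Equiv.Perm.mul_apply, hh, hg, mul_assoc]
  refine ⟨fun g => ((θ g)⁻¹ (1, 0)).2, by simp, fun e => ?_⟩
  have h2 : (θ (tgt e))⁻¹ (1, 0) = stepPerm c e.2 ((θ e.1)⁻¹ (1, 0)) := by
    simp [tgt, θ]
  have h3 := h1 e.1 (1, 0)
  simp only [h2]
  simp only [stepPerm, Equiv.coe_fn_mk]
  rw [h3]
  simp

/-- The Cayley graph is a tree: an edge separates its ends. -/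
lemma not_conn {S : Set (Ed n)} {e : Ed n} (he : e ∉ S) : ¬ Conn S e.1 (tgt e) := by
  classical
  intro h
  obtain ⟨f, -, hf⟩ := integrate (fun e' : Ed n => if e' = e then (1 : ℤ) else 0)
  have := Conn.const f (fun e' he' => by
    have h1 : e' ≠ e := fun h' => he (h' ▸ he')
    simpa [h1] using (hf e').symm) h
  have h2 := hf e
  simp at h2
  omega

variable [LinearOrder (Ed n)]

def Below (G : Set (Ed n)) (e : Ed n) : Set (Ed n) := {f | f ∈ G ∧ f < e}

def Cl (G : Set (Ed n)) (e : Ed n) (u : FreeGroup (Fin n)) : Set (FreeGroup (Fin n)) :=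
  {v | Conn (Below G e) u v}

lemma below_mono {G : Set (Ed n)} {e f : Ed n} (h : e ≤ f) : Below G e ⊆ Below G f :=
  fun _ h' => ⟨h'.1, h'.2.trans_le h⟩

lemma mem_cl_self (G : Set (Ed n)) (e : Ed n) (u : FreeGroup (Fin n)) : u ∈ Cl G e u := Conn.refl _ _

lemma cl_eq {G : Set (Ed n)} {e : Ed n} {u v : FreeGroup (Fin n)} (h : v ∈ Cl G e u) :
    Cl G e u = Cl G e v := by
  ext w
  exact ⟨fun h' => (Conn.symm h).trans h', fun h' => Conn.trans h h'⟩

lemma cl_mono {G : Set (Ed n)} {e f : Ed n} (h : e ≤ f) (u : FreeGroup (Fin n)) :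
    Cl G e u ⊆ Cl G f u := fun _ h' => Conn.mono (below_mono h) h'

def Ess (G : Set (Ed n)) : Set (Ed n) :=
  {e | e ∈ G ∧ (Cl G e e.1).Infinite ∧ (Cl G e (tgt e)).Infinite}

def NE (G : Set (Ed n)) : Set (Ed n) := {e | e ∈ G ∧ e ∉ Ess G}

open Classical in
noncomputable def side (G : Set (Ed n)) (e : Ed n) : FreeGroup (Fin n) :=
  if (Cl G e e.1).Finite then e.1 else tgt e

lemma side_finite {G : Set (Ed n)} {e : Ed n} (h : e ∈ NE G) : (Cl G e (side G e)).Finite := by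
  unfold side
  split_ifs with h1
  · exact h1
  · by_contra h2
    exact h.2 ⟨h.1, h1, h2⟩

/-- `v` is a root at level `e`. -/
def IsRoot (G : Set (Ed n)) (e : Ed n) (v : FreeGroup (Fin n)) : Prop :=
  ∀ f ∈ G, f < e → v ∉ Cl G f f.1

def Tail (G : Set (Ed n)) (e : Ed n) (v : FreeGroup (Fin n)) : Prop :=
  v ∈ Cl G e (side G e) ∧ IsRoot G e v

lemma tail_inj_aux {G : Set (Ed n)} {e f : Ed n} (he : e ∈ NE G) (hf : f ∈ NE G)
    {v : FreeGroup (Fin n)} (h1 : Tail G e v) (h2 : Tail G f v) (hlt : f < e) : False := by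
  have h3 := h1.2 f hf.1 hlt
  have h4 := h2.1
  unfold side at h4
  split_ifs at h4 with h5
  · exact h3 h4
  · apply h5
    have hfin := side_finite he
    rw [cl_eq h1.1] at hfin
    have h6 : tgt f ∈ Cl G e v := cl_mono hlt.le _ (Conn.symm h4)
    have h7 : f.1 ∈ Cl G e v := Conn.trans h6 (Conn.symm (conn_edge ⟨hf.1, hlt⟩))
    rw [cl_eq h7] at hfin
    exact hfin.subset (cl_mono hlt.le _)

lemma tail_inj {G : Set (Ed n)} {e f : Ed n} (he : e ∈ NE G) (hf : f ∈ NE G)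
    {v : FreeGroup (Fin n)} (h1 : Tail G e v) (h2 : Tail G f v) : e = f := by
  rcases lt_trichotomy e f with h | h | h
  · exact (tail_inj_aux hf he h2 h1 h).elim
  · exact h
  · exact (tail_inj_aux he hf h1 h2 h).elim

lemma finite_src {D : Set (FreeGroup (Fin n))} (hD : D.Finite) : {e : Ed n | e.1 ∈ D}.Finite := by
  refine (hD.prod (Set.finite_univ (α := Fin n))).subset ?_
  intro e he
  exact ⟨he, trivial⟩

lemma finite_tgt {D : Set (FreeGroup (Fin n))} (hD : D.Finite) : {e : Ed n | tgt e ∈ D}.Finite := by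
  refine ((hD.prod (Set.finite_univ (α := Fin n))).image
    (fun p => (p.1 * (FreeGroup.of p.2)⁻¹, p.2))).subset ?_
  intro e he
  exact ⟨(tgt e, e.2), ⟨he, trivial⟩, by simp [tgt]⟩

lemma root_aux (G : Set (Ed n)) (k : ℕ) : ∀ (e : Ed n) (u : FreeGroup (Fin n)),
    (Cl G e u).Finite → (Cl G e u).ncard ≤ k → ∃! v, v ∈ Cl G e u ∧ IsRoot G e v := by
  induction k with
  | zero =>
    intro e u hfin hk
    exfalso
    have := (Set.ncard_eq_zero hfin).mp (by omega)
    have h2 := mem_cl_self G e u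
    rw [this] at h2
    exact h2
  | succ k ih =>
    intro e u hfin hk
    let M : Set (Ed n) := {f | f ∈ Below G e ∧ f.1 ∈ Cl G e u}
    have hM : M.Finite := (finite_src hfin).subset fun f hf => hf.2
    -- every edge witnessing failure of rootness lies in `M`
    have hMw : ∀ v ∈ Cl G e u, ∀ f ∈ G, f < e → v ∈ Cl G f f.1 → f ∈ M := by
      intro v hv f hf hfe hvf
      exact ⟨⟨hf, hfe⟩, Conn.trans hv (cl_mono hfe.le _ (Conn.symm hvf))⟩
    rcases M.eq_empty_or_nonempty with hMe | hMn
    · refine ⟨u, ⟨mem_cl_self _ _ _, fun f hf hfe hu => ?_⟩, ?_⟩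
      · have := hMw u (mem_cl_self _ _ _) f hf hfe hu
        rw [hMe] at this; exact this
      · rintro v ⟨hv, -⟩
        rcases Relation.ReflTransGen.cases_head hv with h | ⟨w, ⟨f, hf, hw⟩, -⟩
        · exact h.symm
        · exfalso
          have : f ∈ M := by
            refine ⟨hf, ?_⟩
            rcases hw with hw | hw
            · rw [← hw.1]; exact mem_cl_self _ _ _
            · rw [hw.2]; exact Conn.symm (conn_edge hf)
          rw [hMe] at this; exact this
    · obtain ⟨t, htM, htmax⟩ := Set.exists_max_image M id hM hMn
      have hte : t < e := htM.1.2
      have htgt : tgt t ∈ Cl G e u := Conn.trans htM.2 (conn_edge htM.1)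
      have hsub : Cl G t (tgt t) ⊆ Cl G e u := by
        rw [cl_eq htgt]; exact cl_mono hte.le _
      have hnot : ¬ Conn (Below G t) t.1 (tgt t) := not_conn (fun h => lt_irrefl _ h.2)
      have hss : Cl G t (tgt t) ⊂ Cl G e u := by
        refine ⟨hsub, fun h => hnot (Conn.symm (h htM.2))⟩
      have hcard := Set.ncard_lt_ncard hss hfin
      obtain ⟨v, ⟨hv, hroot⟩, huniq⟩ := ih t (tgt t) (hfin.subset hsub) (by omega)
      refine ⟨v, ⟨hsub hv, ?_⟩, ?_⟩
      · intro f hf hfe hvf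
        have hfM := hMw v (hsub hv) f hf hfe hvf
        have hle : f ≤ t := htmax f hfM
        rcases hle.lt_or_eq with h | h
        · exact hroot f hf h hvf
        · subst h
          exact hnot (Conn.trans hvf (Conn.symm hv))
      · rintro w ⟨hw, hwroot⟩
        apply huniq
        refine ⟨?_, fun f hf hft => hwroot f hf (hft.trans hte)⟩
        have hcov : w ∈ Cl G t t.1 ∨ w ∈ Cl G t (tgt t) := by
          have h0 : Conn (Below G e) t.1 w := Conn.trans (Conn.symm htM.2) hw
          clear hw hwroot
          unfold Conn at h0
          induction h0 with
          | refl => left; exact mem_cl_self _ _ _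
          | @tail a b hab hst ih2 =>
            obtain ⟨f, hf, hstep⟩ := hst
            have hau : a ∈ Cl G e u := Conn.trans htM.2 hab
            have hfM : f ∈ M := by
              refine ⟨hf, ?_⟩
              rcases hstep with hw | hw
              · rw [← hw.1]; exact hau
              · rw [hw.2] at hau; exact Conn.trans hau (Conn.symm (conn_edge hf))
            have hle : f ≤ t := htmax f hfM
            rcases hle.lt_or_eq with h | h
            · have hs : Conn (Below G t) a b :=
                Relation.ReflTransGen.single ⟨f, ⟨hf.1, h⟩, hstep⟩
              exact ih2.imp (fun h => Conn.trans h hs) (fun h => Conn.trans h hs)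
            · subst h
              rcases hstep with hw | hw
              · right; rw [hw.2]; exact mem_cl_self _ _ _
              · left; rw [hw.1]; exact mem_cl_self _ _ _
        exact hcov.resolve_left (hwroot t htM.1.1 hte)

lemma tail_existsUnique {G : Set (Ed n)} {e : Ed n} (he : e ∈ NE G) : ∃! v, Tail G e v :=
  root_aux G _ e (side G e) (side_finite he) le_rfl

/-- If `v` lies in a finite chosen side, it is the tail of some edge. -/
lemma tail_surj_aux {G : Set (Ed n)} {v : FreeGroup (Fin n)} {e : Ed n} (he : e ∈ NE G)
    (hv : v ∈ Cl G e (side G e)) : ∃ f ∈ NE G, Tail G f v := by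
  have hfin := side_finite he
  let M : Set (Ed n) := {f | f ∈ NE G ∧ f ≤ e ∧ v ∈ Cl G f (side G f)}
  have hM : M.Finite := by
    refine ((finite_src hfin).union (finite_tgt hfin)).subset ?_
    rintro f ⟨hf, hfe, hvf⟩
    have : side G f ∈ Cl G e (side G e) := Conn.trans hv (cl_mono hfe _ (Conn.symm hvf))
    by_cases h : (Cl G f f.1).Finite
    · left; simpa [side, h] using this
    · right; simpa [side, h] using this
  obtain ⟨t, htM, htmin⟩ := Set.exists_min_image M id hM ⟨e, he, le_rfl, hv⟩
  refine ⟨t, htM.1, htM.2.2, fun f hf hft hvf => ?_⟩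
  have hfin2 := side_finite htM.1
  rw [cl_eq htM.2.2] at hfin2
  have hfin3 : (Cl G f f.1).Finite := by
    rw [cl_eq hvf]
    exact hfin2.subset (cl_mono hft.le _)
  have hfM : f ∈ M := by
    refine ⟨⟨hf, fun h => h.2.1 hfin3⟩, hft.le.trans htM.2.1, ?_⟩
    simpa [side, hfin3] using hvf
  exact absurd hft (not_lt.mpr (htmin f hfM))

/-- A finite nonempty proper part of a connected graph has a boundary edge. -/
lemma exists_boundary {G : Set (Ed n)} {D : Set (FreeGroup (Fin n))} {u w : FreeGroup (Fin n)}
    (hu : u ∈ D) (hw : w ∉ D) (h : Conn G u w) :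
    ∃ e ∈ G, (e.1 ∈ D ∧ tgt e ∉ D) ∨ (e.1 ∉ D ∧ tgt e ∈ D) := by
  by_contra hcon
  push Not at hcon
  have := Conn.const (fun v => v ∈ D) (S := G) (fun e he => by
    have := hcon e he
    simp only [eq_iff_iff]
    tauto) h
  simp only [eq_iff_iff] at this
  exact hw (this.mp hu)

lemma tail_surj_step {G : Set (Ed n)} {V : Set (FreeGroup (Fin n))} (hinf : V.Infinite)
    (hconn : ∀ u ∈ V, ∀ v ∈ V, Conn G u v) {v : FreeGroup (Fin n)} (hv : v ∈ V)
    {D : Set (FreeGroup (Fin n))} (hD : D.Finite) (hvD : v ∈ D)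
    (hDc : ∀ e ∈ G, (e.1 ∈ D ∧ tgt e ∉ D) ∨ (e.1 ∉ D ∧ tgt e ∈ D) → D ⊆ Cl G e v) :
    (∃ f ∈ NE G, Tail G f v) ∨
      ∃ e ∈ G, Cl G e (tgt e) = D ∧ (Cl G e e.1).Finite := by
  obtain ⟨w, hwV, hwD⟩ : ∃ w ∈ V, w ∉ D := by
    by_contra h
    push Not at h
    exact hinf (hD.subset h)
  obtain ⟨e0, he0, hb0⟩ := exists_boundary hvD hwD (hconn v hv w hwV)
  let M : Set (Ed n) := {e | e ∈ G ∧ ((e.1 ∈ D ∧ tgt e ∉ D) ∨ (e.1 ∉ D ∧ tgt e ∈ D))}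
  have hM : M.Finite := by
    refine ((finite_src hD).union (finite_tgt hD)).subset ?_
    rintro f ⟨-, hf | hf⟩
    · left; exact hf.1
    · right; exact hf.2
  obtain ⟨t, htM, htmin⟩ := Set.exists_min_image M id hM ⟨e0, he0, hb0⟩
  have hcl : Cl G t v = D := by
    apply subset_antisymm
    · intro x hx
      have := Conn.const (fun v => v ∈ D) (fun e he => by
        by_contra hne
        have heM : e ∈ M := by
          refine ⟨he.1, ?_⟩
          simp only [eq_iff_iff] at hne
          tauto
        exact absurd he.2 (not_lt.mpr (htmin e heM))) hx
      simp only [eq_iff_iff] at this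
      exact this.mp hvD
    · exact hDc t htM.1 htM.2
  by_cases hs : t.1 ∈ D
  · left
    have hv' : v ∈ Cl G t t.1 := by rw [← hcl] at hs; exact Conn.symm hs
    have hfin : (Cl G t t.1).Finite := by rw [cl_eq hv', hcl]; exact hD
    exact tail_surj_aux (e := t) ⟨htM.1, fun h => h.2.1 hfin⟩ (by simpa [side, hfin] using hv')
  · have ht : tgt t ∈ D := by
      rcases htM.2 with h | h
      · exact absurd h.1 hs
      · exact h.2
    have hv' : v ∈ Cl G t (tgt t) := by rw [← hcl] at ht; exact Conn.symm ht
    have hfin : (Cl G t (tgt t)).Finite := by rw [cl_eq hv', hcl]; exact hD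
    by_cases hfs : (Cl G t t.1).Finite
    · right; exact ⟨t, htM.1, by rw [cl_eq hv', hcl], hfs⟩
    · left
      exact tail_surj_aux (e := t) ⟨htM.1, fun h => h.2.2 hfin⟩ (by simpa [side, hfs] using hv')

lemma tail_surj {G : Set (Ed n)} {V : Set (FreeGroup (Fin n))} (hinf : V.Infinite)
    (hconn : ∀ u ∈ V, ∀ v ∈ V, Conn G u v)
    (hbdd : ((fun e => (Cl G e (tgt e)).ncard) '' G).Finite)
    {v : FreeGroup (Fin n)} (hv : v ∈ V) : ∃ f ∈ NE G, Tail G f v := by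
  by_contra hno
  let M : Set (Ed n) := {e | e ∈ G ∧ v ∈ Cl G e (tgt e) ∧ (Cl G e (tgt e)).Finite ∧
    (Cl G e e.1).Finite}
  have hMn : M.Nonempty := by
    rcases tail_surj_step hinf hconn hv (Set.finite_singleton v) (Set.mem_singleton v)
      (fun e _ _ x hx => by rw [Set.mem_singleton_iff.mp hx]; exact mem_cl_self _ _ _)
      with h | ⟨e, he, h, hf⟩
    · exact absurd h hno
    · exact ⟨e, he, by rw [h]; rfl, by rw [h]; exact Set.finite_singleton v, hf⟩
  obtain ⟨N, ⟨t, htM, htN⟩, hmax⟩ := Set.exists_max_image ((fun e => (Cl G e (tgt e)).ncard) '' M) id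
    (hbdd.subset (Set.image_mono fun e he => he.1)) (hMn.image _)
  obtain ⟨ht, hvt, hf1, hf2⟩ := htM
  have hDc : ∀ e ∈ G, (e.1 ∈ Cl G t t.1 ∪ Cl G t (tgt t) ∧ tgt e ∉ Cl G t t.1 ∪ Cl G t (tgt t)) ∨
      (e.1 ∉ Cl G t t.1 ∪ Cl G t (tgt t) ∧ tgt e ∈ Cl G t t.1 ∪ Cl G t (tgt t)) →
      Cl G t t.1 ∪ Cl G t (tgt t) ⊆ Cl G e v := by
    intro e he hb
    have hte : t < e := by
      rcases lt_trichotomy t e with h | h | h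
      · exact h
      · exfalso
        subst h
        have h1 := mem_cl_self G t t.1
        have h2 := mem_cl_self G t (tgt t)
        rcases hb with hb | hb
        · exact hb.2 (Or.inr h2)
        · exact hb.1 (Or.inl h1)
      · exfalso
        have hst : Conn (Below G t) e.1 (tgt e) := conn_edge ⟨he, h⟩
        rcases hb with ⟨hb1, hb2⟩ | ⟨hb1, hb2⟩
        · apply hb2
          exact hb1.imp (fun h => Conn.trans h hst) (fun h => Conn.trans h hst)
        · apply hb1
          exact hb2.imp (fun h => Conn.trans h hst.symm) (fun h => Conn.trans h hst.symm)
    have h1 : Conn (Below G e) v (tgt t) := (cl_mono hte.le _ hvt).symm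
    rintro x (hx | hx)
    · exact (h1.trans (Conn.symm (conn_edge ⟨ht, hte⟩))).trans (cl_mono hte.le _ hx)
    · exact h1.trans (cl_mono hte.le _ hx)
  rcases tail_surj_step hinf hconn hv (hf2.union hf1) (Or.inr hvt) hDc with h | ⟨e, he, h, hf⟩
  · exact absurd h hno
  · have heM : e ∈ M := ⟨he, by rw [h]; exact Or.inr hvt, by rw [h]; exact hf2.union hf1, hf⟩
    have h1 := hmax _ ⟨e, heM, rfl⟩
    simp only [id, h, ← htN] at h1
    have hlt : (Cl G t (tgt t)).ncard < (Cl G t t.1 ∪ Cl G t (tgt t)).ncard := by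
      refine Set.ncard_lt_ncard ⟨Set.subset_union_right, fun h => ?_⟩ (hf2.union hf1)
      have h2 := h (Or.inl (mem_cl_self G t t.1))
      exact not_conn (S := Below G t) (e := t) (fun h => lt_irrefl _ h.2) (Conn.symm h2)
    omega

end graph

end RG

namespace RG

section equiv
variable {n : ℕ} [NeZero n]

/-! ### Orbits -/

def pr (A : Subgroup (FreeGroup (Fin n))) (g : FreeGroup (Fin n)) :
    Quotient (QuotientGroup.rightRel A) := Quotient.mk _ g

lemma pr_eq {A : Subgroup (FreeGroup (Fin n))} {g h : FreeGroup (Fin n)} :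
    pr A g = pr A h ↔ ∃ a ∈ A, h = a * g := by
  unfold pr
  rw [Quotient.eq, QuotientGroup.rightRel_apply]
  constructor
  · intro h'; exact ⟨_, h', by group⟩
  · rintro ⟨a, ha, rfl⟩; simpa using ha

def prE (A : Subgroup (FreeGroup (Fin n))) (e : Ed n) :
    Quotient (QuotientGroup.rightRel A) × Fin n := (pr A e.1, e.2)

lemma prE_eq {A : Subgroup (FreeGroup (Fin n))} {e f : Ed n} :
    prE A e = prE A f ↔ ∃ a ∈ A, f = act a e := by
  unfold prE
  rw [Prod.ext_iff]
  simp only [pr_eq, act]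
  constructor
  · rintro ⟨⟨a, ha, h⟩, h2⟩; exact ⟨a, ha, Prod.ext h h2.symm⟩
  · rintro ⟨a, ha, rfl⟩; exact ⟨⟨a, ha, rfl⟩, rfl⟩

lemma act_inv_act (a : FreeGroup (Fin n)) (e : Ed n) : act a⁻¹ (act a e) = e := by
  simp [act]

lemma act_act_inv (a : FreeGroup (Fin n)) (e : Ed n) : act a (act a⁻¹ e) = e := by
  simp [act]

lemma tgt_act (a : FreeGroup (Fin n)) (e : Ed n) : tgt (act a e) = a * tgt e := by
  simp [act, tgt, mul_assoc]

variable [LinearOrder (Ed n)]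

lemma cl_act_sub (hord : ∀ (g : FreeGroup (Fin n)) (e f : Ed n), e < f → act g e < act g f)
    {A : Subgroup (FreeGroup (Fin n))} {G : Set (Ed n)} (hG : ∀ a ∈ A, ∀ e ∈ G, act a e ∈ G)
    {a : FreeGroup (Fin n)} (ha : a ∈ A) {e : Ed n} {u v : FreeGroup (Fin n)}
    (h : v ∈ Cl G e u) : a * v ∈ Cl G (act a e) (a * u) :=
  Conn.act (S := Below G e) (S' := Below G (act a e)) a
    (fun f hf => ⟨hG a ha f hf.1, hord a _ _ hf.2⟩) h

lemma cl_act (hord : ∀ (g : FreeGroup (Fin n)) (e f : Ed n), e < f → act g e < act g f)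
    {A : Subgroup (FreeGroup (Fin n))} {G : Set (Ed n)} (hG : ∀ a ∈ A, ∀ e ∈ G, act a e ∈ G)
    {a : FreeGroup (Fin n)} (ha : a ∈ A) (e : Ed n) (u : FreeGroup (Fin n)) :
    Cl G (act a e) (a * u) = (fun v => a * v) '' Cl G e u := by
  ext v
  constructor
  · intro h
    refine ⟨a⁻¹ * v, ?_, by simp⟩
    have := cl_act_sub hord hG (A.inv_mem ha) h
    simpa [act_inv_act] using this
  · rintro ⟨w, hw, rfl⟩
    exact cl_act_sub hord hG ha hw

lemma ess_act (hord : ∀ (g : FreeGroup (Fin n)) (e f : Ed n), e < f → act g e < act g f)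
    {A : Subgroup (FreeGroup (Fin n))} {G : Set (Ed n)} (hG : ∀ a ∈ A, ∀ e ∈ G, act a e ∈ G)
    {a : FreeGroup (Fin n)} (ha : a ∈ A) {e : Ed n} (he : e ∈ Ess G) : act a e ∈ Ess G := by
  refine ⟨hG a ha e he.1, ?_, ?_⟩
  · have := cl_act hord hG ha e e.1
    rw [show (act a e).1 = a * e.1 from rfl, this]
    exact he.2.1.image (mul_right_injective a).injOn
  · rw [tgt_act, cl_act hord hG ha]
    exact he.2.2.image (mul_right_injective a).injOn

lemma ne_act (hord : ∀ (g : FreeGroup (Fin n)) (e f : Ed n), e < f → act g e < act g f)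
    {A : Subgroup (FreeGroup (Fin n))} {G : Set (Ed n)} (hG : ∀ a ∈ A, ∀ e ∈ G, act a e ∈ G)
    {a : FreeGroup (Fin n)} (ha : a ∈ A) {e : Ed n} (he : e ∈ NE G) : act a e ∈ NE G := by
  refine ⟨hG a ha e he.1, fun h => he.2 ?_⟩
  have := ess_act hord hG (A.inv_mem ha) h
  rwa [act_inv_act] at this

lemma side_act (hord : ∀ (g : FreeGroup (Fin n)) (e f : Ed n), e < f → act g e < act g f)
    {A : Subgroup (FreeGroup (Fin n))} {G : Set (Ed n)} (hG : ∀ a ∈ A, ∀ e ∈ G, act a e ∈ G)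
    {a : FreeGroup (Fin n)} (ha : a ∈ A) (e : Ed n) : side G (act a e) = a * side G e := by
  have h : (Cl G (act a e) (act a e).1).Finite ↔ (Cl G e e.1).Finite := by
    rw [show (act a e).1 = a * e.1 from rfl, cl_act hord hG ha,
      Set.finite_image_iff (mul_right_injective a).injOn]
  unfold side
  by_cases h1 : (Cl G e e.1).Finite
  · rw [if_pos h1, if_pos (h.mpr h1)]; rfl
  · rw [if_neg h1, if_neg (fun h2 => h1 (h.mp h2)), tgt_act]

lemma tail_act (hord : ∀ (g : FreeGroup (Fin n)) (e f : Ed n), e < f → act g e < act g f)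
    {A : Subgroup (FreeGroup (Fin n))} {G : Set (Ed n)} (hG : ∀ a ∈ A, ∀ e ∈ G, act a e ∈ G)
    {a : FreeGroup (Fin n)} (ha : a ∈ A) {e : Ed n} {v : FreeGroup (Fin n)} (h : Tail G e v) :
    Tail G (act a e) (a * v) := by
  refine ⟨?_, ?_⟩
  · rw [side_act hord hG ha]
    exact cl_act_sub hord hG ha h.1
  · intro f hf hfe hv
    have h1 := cl_act_sub hord hG (A.inv_mem ha) hv
    rw [inv_mul_cancel_left] at h1
    refine h.2 (act a⁻¹ f) (hG _ (A.inv_mem ha) f hf) ?_ h1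
    have := hord a⁻¹ _ _ hfe
    rwa [act_inv_act] at this

lemma ncard_ne_le (hord : ∀ (g : FreeGroup (Fin n)) (e f : Ed n), e < f → act g e < act g f)
    {A : Subgroup (FreeGroup (Fin n))} {G : Set (Ed n)} (hG : ∀ a ∈ A, ∀ e ∈ G, act a e ∈ G)
    {V : Set (FreeGroup (Fin n))} (hend : ∀ e ∈ G, e.1 ∈ V ∧ tgt e ∈ V)
    (hfin : (pr A '' V).Finite) : (prE A '' NE G).ncard ≤ (pr A '' V).ncard := by
  have hrep : ∀ q ∈ prE A '' NE G, ∃ w, ∃ e ∈ NE G, ∃ v ∈ V, prE A e = q ∧ Tail G e v ∧ pr A v = w := by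
    rintro q ⟨e, he, rfl⟩
    obtain ⟨v, hv, -⟩ := tail_existsUnique he
    refine ⟨_, e, he, v, ?_, rfl, hv, rfl⟩
    have h1 : side G e ∈ V := by
      unfold side; split_ifs
      · exact (hend e he.1).1
      · exact (hend e he.1).2
    have := Conn.const (fun v => v ∈ V) (fun f hf => by
      have := hend f hf.1
      simp [this.1, this.2]) hv.1
    simp only [eq_iff_iff] at this
    exact this.mp h1
  choose! F hF using hrep
  refine Set.ncard_le_ncard_of_injOn F ?_ ?_ hfin
  · intro q hq
    obtain ⟨e, he, v, hv, h1, h2, h3⟩ := hF q hq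
    exact ⟨v, hv, h3⟩
  · intro q hq q' hq' hqq
    obtain ⟨e, he, v, hv, h1, h2, h3⟩ := hF q hq
    obtain ⟨e', he', v', hv', h1', h2', h3'⟩ := hF q' hq'
    rw [← h3, ← h3'] at hqq
    obtain ⟨a, ha, hav⟩ := pr_eq.mp hqq
    have h4 := tail_act hord hG ha h2
    rw [← hav] at h4
    have := tail_inj (ne_act hord hG ha he) he' h4 h2'
    rw [← h1, ← h1']
    exact prE_eq.mpr ⟨a, ha, this.symm⟩

lemma ncard_ne_ge (hord : ∀ (g : FreeGroup (Fin n)) (e f : Ed n), e < f → act g e < act g f)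
    {A : Subgroup (FreeGroup (Fin n))} {G : Set (Ed n)} (hG : ∀ a ∈ A, ∀ e ∈ G, act a e ∈ G)
    {V : Set (FreeGroup (Fin n))} (hinf : V.Infinite)
    (hconn : ∀ u ∈ V, ∀ v ∈ V, Conn G u v)
    (hfin : (prE A '' G).Finite) : (pr A '' V).ncard ≤ (prE A '' NE G).ncard := by
  have hbdd : ((fun e => (Cl G e (tgt e)).ncard) '' G).Finite := by
    choose! r hr using (fun q (hq : q ∈ prE A '' G) => hq)
    refine (hfin.image (fun q => (Cl G (r q) (tgt (r q))).ncard)).subset ?_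
    rintro _ ⟨e, he, rfl⟩
    refine ⟨prE A e, ⟨e, he, rfl⟩, ?_⟩
    have h1 := hr (prE A e) ⟨e, he, rfl⟩
    obtain ⟨a, ha, hae⟩ := prE_eq.mp h1.2
    have : (Cl G e (tgt e)).ncard = (Cl G (r (prE A e)) (tgt (r (prE A e)))).ncard := by
      conv_lhs => rw [hae]
      rw [tgt_act, cl_act hord hG ha, Set.ncard_image_of_injective _ (mul_right_injective a)]
    exact this.symm
  have hrep : ∀ w ∈ pr A '' V, ∃ q, ∃ e ∈ NE G, ∃ v ∈ V, prE A e = q ∧ Tail G e v ∧ pr A v = w := by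
    rintro w ⟨v, hv, rfl⟩
    obtain ⟨e, he, ht⟩ := tail_surj hinf hconn hbdd hv
    exact ⟨_, e, he, v, hv, rfl, ht, rfl⟩
  choose! F hF using hrep
  refine Set.ncard_le_ncard_of_injOn F ?_ ?_ (hfin.subset (Set.image_mono fun e he => he.1))
  · intro q hq
    obtain ⟨e, he, v, hv, h1, h2, h3⟩ := hF q hq
    exact ⟨e, he, h1⟩
  · intro q hq q' hq' hqq
    obtain ⟨e, he, v, hv, h1, h2, h3⟩ := hF q hq
    obtain ⟨e', he', v', hv', h1', h2', h3'⟩ := hF q' hq'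
    rw [← h1, ← h1'] at hqq
    obtain ⟨a, ha, hav⟩ := prE_eq.mp hqq
    have h4 := tail_act hord hG ha h2
    rw [← hav] at h4
    have := (tail_existsUnique he').unique h4 h2'
    rw [← h3, ← h3']
    exact pr_eq.mpr ⟨a, ha, this.symm⟩

lemma ncard_split (hord : ∀ (g : FreeGroup (Fin n)) (e f : Ed n), e < f → act g e < act g f)
    {A : Subgroup (FreeGroup (Fin n))} {G : Set (Ed n)} (hG : ∀ a ∈ A, ∀ e ∈ G, act a e ∈ G)
    (hfin : (prE A '' G).Finite) :
    (prE A '' G).ncard = (prE A '' Ess G).ncard + (prE A '' NE G).ncard := by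
  have h1 : prE A '' G = prE A '' Ess G ∪ prE A '' NE G := by
    rw [← Set.image_union]
    congr 1
    ext e
    by_cases h : e ∈ Ess G
    · simp [h, h.1]
    · simp [NE, h]
  rw [h1]
  refine Set.ncard_union_eq ?_ (hfin.subset (Set.image_mono fun e he => he.1))
    (hfin.subset (Set.image_mono fun e he => he.1))
  rw [Set.disjoint_left]
  rintro _ ⟨e, he, rfl⟩ ⟨f, hf, hfe⟩
  obtain ⟨a, ha, rfl⟩ := prE_eq.mp hfe
  exact (ne_act hord hG ha hf).2 he

end equiv

/-! ### The rank formula -/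

section rank
variable {n : ℕ} [NeZero n]

noncomputable def coef (A : Subgroup (FreeGroup (Fin n))) (g : FreeGroup (Fin n)) :
    FreeGroup (Fin n) := g * (Quotient.out (pr A g))⁻¹

lemma coef_mem (A : Subgroup (FreeGroup (Fin n))) (g : FreeGroup (Fin n)) : coef A g ∈ A := by
  have : pr A (Quotient.out (pr A g)) = pr A g := Quotient.out_eq _
  obtain ⟨a, ha, h⟩ := pr_eq.mp this
  unfold coef
  have h2 : g * (Quotient.out (pr A g))⁻¹ = a := mul_inv_eq_of_eq_mul h
  rwa [h2]

lemma pr_act {A : Subgroup (FreeGroup (Fin n))} {a : FreeGroup (Fin n)} (ha : a ∈ A)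
    (g : FreeGroup (Fin n)) : pr A (a * g) = pr A g := (pr_eq.mpr ⟨a, ha, rfl⟩).symm

lemma coef_act {A : Subgroup (FreeGroup (Fin n))} {a : FreeGroup (Fin n)} (ha : a ∈ A)
    (g : FreeGroup (Fin n)) : coef A (a * g) = a * coef A g := by
  unfold coef
  rw [pr_act ha, mul_assoc]

def Quasi (A : Subgroup (FreeGroup (Fin n))) (V : Set (FreeGroup (Fin n))) : Type :=
  {p : (FreeGroup (Fin n) → ZMod 2) × (A →* Multiplicative (ZMod 2)) //
    (∀ v ∉ V, p.1 v = 0) ∧ ∀ (a : A), ∀ v ∈ V, p.1 (a * v) = p.1 v + (p.2 a).toAdd}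

open Classical in
lemma quasi_card_one {A : Subgroup (FreeGroup (Fin n))} {G : Set (Ed n)}
    {V : Set (FreeGroup (Fin n))} (hG : ∀ a ∈ A, ∀ e ∈ G, act a e ∈ G)
    (hV : ∀ a ∈ A, ∀ v ∈ V, a * v ∈ V) (hend : ∀ e ∈ G, e.1 ∈ V ∧ tgt e ∈ V)
    (h1 : 1 ∈ V) (hconn : ∀ v ∈ V, Conn G 1 v) (hfin : (prE A '' G).Finite) :
    Nat.card (Quasi A V) = 2 ^ (1 + (prE A '' G).ncard) := by
  choose! r hr using (fun q (hq : q ∈ prE A '' G) => hq)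
  let Φ : Quasi A V → ZMod 2 × (↥(prE A '' G) → ZMod 2) := fun p =>
    (p.1.1 1, fun q => p.1.1 (tgt (r q)) - p.1.1 (r q).1)
  have hbij : Function.Bijective Φ := by
    constructor
    · rintro ⟨⟨f, φ⟩, hf0, hf⟩ ⟨⟨f', φ'⟩, hf0', hf'⟩ h
      simp only [Φ, Prod.mk.injEq] at h
      obtain ⟨ha, hb⟩ := h
      simp only at hf0 hf hf0' hf'
      have hff : f = f' := by
        funext v
        by_cases hv : v ∈ V
        · have := Conn.const (fun v => f v - f' v) (fun e he => by
            have hq : prE A e ∈ prE A '' G := ⟨e, he, rfl⟩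
            have hb' := congrFun hb ⟨_, hq⟩
            simp only at hb'
            obtain ⟨hrG, hre⟩ := hr _ hq
            obtain ⟨a, haA, hae⟩ := prE_eq.mp hre
            have hE := hend _ hrG
            have t1 : tgt e = a * tgt (r (prE A e)) := by
              conv_lhs => rw [hae]
              exact tgt_act _ _
            have t2 : e.1 = a * (r (prE A e)).1 := by
              conv_lhs => rw [hae]
              rfl
            have e1 := hf ⟨a, haA⟩ _ hE.1
            have e2 := hf ⟨a, haA⟩ _ hE.2
            have e3 := hf' ⟨a, haA⟩ _ hE.1
            have e4 := hf' ⟨a, haA⟩ _ hE.2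
            simp only at e1 e2 e3 e4
            show f e.1 - f' e.1 = f (tgt e) - f' (tgt e)
            rw [t1, t2, e1, e2, e3, e4]
            linear_combination (-1 : ZMod 2) * hb') (hconn v hv)
          simp only [ha, sub_self] at this
          exact (sub_eq_zero.mp this.symm)
        · rw [hf0 v hv, hf0' v hv]
      subst hff
      have hφ : φ = φ' := by
        refine MonoidHom.ext fun a => ?_
        have e1 := hf a 1 h1
        have e2 := hf' a 1 h1
        rw [e1] at e2
        have e3 : (φ a).toAdd = (φ' a).toAdd := add_left_cancel e2
        exact Multiplicative.toAdd.injective e3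
      subst hφ
      rfl
    · rintro ⟨k, c⟩
      obtain ⟨f, hf1, hf⟩ := integrate (fun e : Ed n =>
        if h : prE A e ∈ prE A '' G then c ⟨_, h⟩ else 0)
      have hshift : ∀ a ∈ A, ∀ g, f (a * g) - f g = f a := by
        intro a ha g
        have hall : Conn (Set.univ : Set (Ed n)) 1 g := by
          induction g using FreeGroup.induction_on with
          | C1 => exact Conn.refl _ _
          | of x => simpa [tgt] using conn_edge (Set.mem_univ ((1, x) : Ed n))
          | inv_of x h =>
            simpa [tgt] using (conn_edge (Set.mem_univ (((FreeGroup.of x)⁻¹, x) : Ed n))).symm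
          | mul g h hg hh =>
            refine hg.trans ?_
            simpa using Conn.act g (S' := Set.univ) (fun _ _ => trivial) hh
        have := Conn.const (fun g => f (a * g) - f g) (fun e _ => by
          have t1 := hf e
          have t2 := hf (act a e)
          rw [tgt_act] at t2
          have t3 : prE A (act a e) = prE A e := (prE_eq.mpr ⟨a, ha, rfl⟩).symm
          simp only [t3] at t2
          show f (a * e.1) - f e.1 = f (a * tgt e) - f (tgt e)
          rw [t1, t2]
          simp only [act]
          ring) hall
        simp only [mul_one, hf1, sub_zero] at this
        exact this.symm
      let φ : A →* Multiplicative (ZMod 2) :=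
        { toFun := fun a => Multiplicative.ofAdd (f a)
          map_one' := by simp [hf1]
          map_mul' := fun a b => by
            have := hshift a a.2 b
            rw [← ofAdd_add]
            congr 1
            simp only [Subgroup.coe_mul]
            linear_combination this }
      refine ⟨⟨⟨fun v => if v ∈ V then f v + k else 0, φ⟩, ?_, ?_⟩, ?_⟩
      · intro v hv; simp [hv]
      · intro a v hv
        have := hshift a a.2 v
        simp only [hv, hV a a.2 v hv, if_true, φ, MonoidHom.coe_mk, OneHom.coe_mk, toAdd_ofAdd]
        linear_combination this
      · simp only [Φ, Prod.mk.injEq]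
        refine ⟨by simp [h1, hf1], ?_⟩
        funext q
        obtain ⟨hrG, hre⟩ := hr _ q.2
        have hE := hend _ hrG
        have t := hf (r q)
        simp only [hE.1, hE.2, if_true, t, hre]
        simp
  have : Finite ↥(prE A '' G) := hfin
  rw [Nat.card_congr (Equiv.ofBijective Φ hbij), Nat.card_prod, Nat.card_fun]
  simp [Nat.card_coe_set_eq, pow_add]

open Classical in
lemma quasi_card_two {A : Subgroup (FreeGroup (Fin n))} {B : Set (FreeGroup (Fin n))}
    (hBf : B.Finite) (hB : IsFreeBasis A B)
    {V : Set (FreeGroup (Fin n))} 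
    (hV : ∀ a ∈ A, ∀ v ∈ V, a * v ∈ V) (hfin : (pr A '' V).Finite) :
    Nat.card (Quasi A V) = 2 ^ ((pr A '' V).ncard + B.ncard) := by
  obtain ⟨hBA, hbij0⟩ := hB
  let E : FreeGroup B ≃* A := MulEquiv.ofBijective _ hbij0
  have hE : ∀ b : B, E (FreeGroup.of b) = ⟨b, hBA b b.2⟩ := fun b => by simp [E]
  have hout : ∀ q ∈ pr A '' V, Quotient.out q ∈ V := by
    rintro _ ⟨v, hv, rfl⟩
    have := hV _ (A.inv_mem (coef_mem A v)) v hv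
    simpa [coef] using this
  let Φ : Quasi A V → (↥(pr A '' V) → ZMod 2) × (B → ZMod 2) := fun p =>
    (fun q => p.1.1 (Quotient.out q.1), fun b => (p.1.2 ⟨b, hBA b b.2⟩).toAdd)
  have hdec : ∀ v, v = coef A v * Quotient.out (pr A v) := fun v => by simp [coef]
  have hbij : Function.Bijective Φ := by
    constructor
    · rintro ⟨⟨f, φ⟩, hf0, hf⟩ ⟨⟨f', φ'⟩, hf0', hf'⟩ h
      simp only [Φ, Prod.mk.injEq] at h
      obtain ⟨ha, hb⟩ := h
      simp only at hf0 hf hf0' hf'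
      have hφ : φ = φ' := by
        have : φ.comp E.toMonoidHom = φ'.comp E.toMonoidHom := by
          apply FreeGroup.ext_hom
          intro b
          have := congrFun hb b
          simp only [MonoidHom.comp_apply, MulEquiv.toMonoidHom_eq_coe, MonoidHom.coe_coe, hE]
          exact this
        ext a
        have h2 := DFunLike.congr_fun this (E.symm a)
        simp only [MonoidHom.comp_apply, MulEquiv.toMonoidHom_eq_coe, MonoidHom.coe_coe,
          MulEquiv.apply_symm_apply] at h2
        rw [h2]
      subst hφ
      have hff : f = f' := by
        funext v
        by_cases hv : v ∈ V
        · have hq : pr A v ∈ pr A '' V := ⟨v, hv, rfl⟩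
          have e1 := hf ⟨_, coef_mem A v⟩ _ (hout _ hq)
          have e2 := hf' ⟨_, coef_mem A v⟩ _ (hout _ hq)
          simp only [← hdec] at e1 e2
          rw [e1, e2]
          have := congrFun ha ⟨_, hq⟩
          simp only at this
          rw [this]
        · rw [hf0 v hv, hf0' v hv]
      subst hff
      rfl
    · rintro ⟨k, c⟩
      let φ : A →* Multiplicative (ZMod 2) :=
        (FreeGroup.lift (fun b : B => Multiplicative.ofAdd (c b))).comp E.symm.toMonoidHom
      refine ⟨⟨⟨fun v => if h : v ∈ V then k ⟨pr A v, ⟨v, h, rfl⟩⟩ +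
        (φ ⟨_, coef_mem A v⟩).toAdd else 0, φ⟩, ?_, ?_⟩, ?_⟩
      · intro v hv; simp [hv]
      · intro a v hv
        have h3 : (⟨coef A (a * v), coef_mem A _⟩ : A) = a * ⟨coef A v, coef_mem A v⟩ :=
          Subtype.ext (coef_act a.2 v)
        simp only [hv, hV a a.2 v hv, dif_pos, h3, pr_act a.2, _root_.map_mul, toAdd_mul]
        ring
      · simp only [Φ, Prod.mk.injEq]
        constructor
        · funext q
          have hq := hout q.1 q.2
          have hpr : pr A (Quotient.out q.1) = q.1 := Quotient.out_eq _
          have h3 : (⟨coef A (Quotient.out q.1), coef_mem A _⟩ : A) = 1 := by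
            apply Subtype.ext
            simp [coef, hpr]
          simp only [hq, dif_pos, h3, _root_.map_one, toAdd_one, add_zero]
          congr 1
          exact Subtype.ext hpr
        · funext b
          have : E.symm ⟨b, hBA b b.2⟩ = FreeGroup.of b := by
            rw [← hE b, MulEquiv.symm_apply_apply]
          simp only [φ, MonoidHom.comp_apply, MulEquiv.toMonoidHom_eq_coe, MonoidHom.coe_coe, this]
          simp
  have : Finite ↥(pr A '' V) := hfin
  have : Finite ↥B := hBf
  rw [Nat.card_congr (Equiv.ofBijective Φ hbij), Nat.card_prod, Nat.card_fun, Nat.card_fun]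
  simp [Nat.card_coe_set_eq, pow_add]

end rank

/-! ### The graph of the subgroup generated by short elements -/

section ball
variable {n : ℕ} [NeZero n]

def HI (H : Subgroup (FreeGroup (Fin n))) (i : ℕ) : Subgroup (FreeGroup (Fin n)) :=
  Subgroup.closure {h : FreeGroup (Fin n) | h ∈ H ∧ FreeGroup.norm h ≤ i}

def VI (A : Subgroup (FreeGroup (Fin n))) (i : ℕ) : Set (FreeGroup (Fin n)) :=
  {g | ∃ a ∈ A, 2 * FreeGroup.norm (a⁻¹ * g) ≤ i + 1}

def GI (A : Subgroup (FreeGroup (Fin n))) (i : ℕ) : Set (Ed n) :=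
  {e | ∃ a ∈ A, FreeGroup.norm (a⁻¹ * e.1) + FreeGroup.norm (a⁻¹ * tgt e) ≤ i}

lemma norm_step (g : FreeGroup (Fin n)) (x : Fin n) :
    norm (g * of x) ≤ norm g + 1 ∧ norm g ≤ norm (g * of x) + 1 := by
  constructor
  · have := norm_mul_le g (of x)
    rwa [norm_of] at this
  · have := norm_mul_le (g * of x) (of x)⁻¹
    rw [norm_inv_eq, norm_of] at this
    simpa using this

/-- One can shorten a nontrivial element by a letter. -/
lemma exists_shorten (g : FreeGroup (Fin n)) (hg : g ≠ 1) : ∃ g' : FreeGroup (Fin n),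
    norm g = norm g' + 1 ∧ ∃ e : Ed n, (g' = e.1 ∧ g = tgt e) ∨ (g = e.1 ∧ g' = tgt e) := by
  have hne : g.toWord ≠ [] := by simpa using hg
  obtain ⟨L, p, hL⟩ := (List.eq_nil_or_concat g.toWord).resolve_left hne
  have hred : FreeGroup.IsReduced L := by
    have hw := isReduced_toWord (x := g)
    rw [hL, List.concat_eq_append] at hw
    exact List.IsChain.left_of_append hw
  have hnorm : norm (FreeGroup.mk L) = L.length := by
    unfold FreeGroup.norm; rw [toWord_mk, hred.reduce_eq]
  have hgm : g = FreeGroup.mk L * FreeGroup.mk [p] := by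
    rw [mul_mk, ← List.concat_eq_append, ← hL, mk_toWord]
  refine ⟨FreeGroup.mk L, ?_, ?_⟩
  · rw [hnorm]; unfold FreeGroup.norm; rw [hL]; simp
  · obtain ⟨x, b⟩ := p
    cases b
    · refine ⟨(g, x), Or.inr ⟨rfl, ?_⟩⟩
      have : FreeGroup.mk [(x, false)] = (of x)⁻¹ := rfl
      simp [tgt, hgm, this]
    · exact ⟨(FreeGroup.mk L, x), Or.inl ⟨rfl, hgm⟩⟩

lemma step_GI {A : Subgroup (FreeGroup (Fin n))} {i : ℕ} {u v a : FreeGroup (Fin n)} (ha : a ∈ A)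
    (h : norm (a⁻¹ * u) + norm (a⁻¹ * v) ≤ i)
    (he : ∃ e : Ed n, (u = e.1 ∧ v = tgt e) ∨ (v = e.1 ∧ u = tgt e)) : Conn (GI A i) u v := by
  obtain ⟨e, he⟩ := he
  refine Relation.ReflTransGen.single ⟨e, ⟨a, ha, ?_⟩, he⟩
  rcases he with he | he
  · rw [← he.1, ← he.2]; exact h
  · rw [← he.1, ← he.2]; omega

lemma GI_act {A : Subgroup (FreeGroup (Fin n))} {i : ℕ} : ∀ a ∈ A, ∀ e ∈ GI A i, act a e ∈ GI A i := by
  rintro a ha e ⟨b, hb, h⟩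
  refine ⟨a * b, A.mul_mem ha hb, ?_⟩
  rw [tgt_act]
  simp only [act]
  rwa [show (a * b)⁻¹ * (a * e.1) = b⁻¹ * e.1 by group,
    show (a * b)⁻¹ * (a * tgt e) = b⁻¹ * tgt e by group]

lemma VI_act {A : Subgroup (FreeGroup (Fin n))} {i : ℕ} : ∀ a ∈ A, ∀ v ∈ VI A i, a * v ∈ VI A i := by
  rintro a ha e ⟨b, hb, h⟩
  refine ⟨a * b, A.mul_mem ha hb, ?_⟩
  rwa [show (a * b)⁻¹ * (a * e) = b⁻¹ * e by group]

lemma GI_end {A : Subgroup (FreeGroup (Fin n))} {i : ℕ} : ∀ e ∈ GI A i, e.1 ∈ VI A i ∧ tgt e ∈ VI A i := by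
  rintro e ⟨a, ha, h⟩
  have := norm_step (a⁻¹ * e.1) e.2
  rw [mul_assoc] at this
  change norm (a⁻¹ * tgt e) ≤ _ ∧ _ ≤ norm (a⁻¹ * tgt e) + 1 at this
  exact ⟨⟨a, ha, by omega⟩, ⟨a, ha, by omega⟩⟩

lemma one_mem_VI {A : Subgroup (FreeGroup (Fin n))} {i : ℕ} : 1 ∈ VI A i :=
  ⟨1, A.one_mem, by simp⟩

lemma ball_conn {A : Subgroup (FreeGroup (Fin n))} {i : ℕ} (k : ℕ) : ∀ g : FreeGroup (Fin n),
    norm g = k → 2 * norm g ≤ i + 1 → Conn (GI A i) 1 g := by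
  induction k with
  | zero =>
    intro g hg _
    rw [FreeGroup.norm_eq_zero] at hg
    rw [hg]; exact Conn.refl _ _
  | succ k ih =>
    intro g hg hi
    obtain ⟨g', h1, e, he⟩ := exists_shorten g (by rintro rfl; simp at hg)
    refine (ih g' (by omega) (by omega)).trans (step_GI A.one_mem ?_ ⟨e, he⟩)
    simp only [inv_one, one_mul]
    omega

lemma gen_conn {A : Subgroup (FreeGroup (Fin n))} {i : ℕ} {s : FreeGroup (Fin n)} (hs : s ∈ A)
    (hi : norm s ≤ i) (k : ℕ) : ∀ g : FreeGroup (Fin n),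
    norm g = k → norm g + norm (s⁻¹ * g) ≤ norm s → Conn (GI A i) 1 g := by
  induction k with
  | zero =>
    intro g hg _
    rw [FreeGroup.norm_eq_zero] at hg
    rw [hg]; exact Conn.refl _ _
  | succ k ih =>
    intro g hg hn
    obtain ⟨g', h1, e, he⟩ := exists_shorten g (by rintro rfl; simp at hg)
    have h2 : norm (s⁻¹ * g') ≤ norm (s⁻¹ * g) + 1 := by
      rcases he with he | he
      · have := (norm_step (s⁻¹ * e.1) e.2).2
        rw [mul_assoc] at this
        rw [he.1, he.2]; exact this
      · have := (norm_step (s⁻¹ * e.1) e.2).1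
        rw [mul_assoc] at this
        rw [he.1, he.2]; exact this
    refine (ih g' (by omega) (by omega)).trans ?_
    by_cases hc : norm g' + norm g ≤ i
    · refine step_GI A.one_mem ?_ ⟨e, he⟩
      simpa using hc
    · exact step_GI hs (by omega) ⟨e, he⟩

lemma VI_conn_one (H : Subgroup (FreeGroup (Fin n))) (i : ℕ) :
    ∀ v ∈ VI (HI H i) i, Conn (GI (HI H i) i) 1 v := by
  have hA : ∀ a ∈ HI H i, Conn (GI (HI H i) i) 1 a := by
    intro a ha
    induction ha using Subgroup.closure_induction with
    | mem s hs =>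
      exact gen_conn (Subgroup.subset_closure hs) hs.2 _ s rfl (by simp)
    | one => exact Conn.refl _ _
    | mul a b ha hb h1 h2 =>
      refine h1.trans ?_
      simpa using Conn.act (S' := GI (HI H i) i) a (GI_act (A := HI H i) a ha) h2
    | inv a ha h1 =>
      have := Conn.act (S' := GI (HI H i) i) a⁻¹
        (GI_act (A := HI H i) a⁻¹ (Subgroup.inv_mem _ ha)) h1
      simpa using this.symm
  rintro v ⟨a, ha, h⟩
  refine (hA a ha).trans ?_
  have := Conn.act a (GI_act a ha) (ball_conn (A := HI H i) _ (a⁻¹ * v) rfl h)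
  simpa using this

lemma finite_norm_le (k : ℕ) : {g : FreeGroup (Fin n) | norm g ≤ k}.Finite := by
  refine Set.Finite.of_finite_image (f := FreeGroup.toWord)
    ((List.finite_length_le (Fin n × Bool) k).subset ?_) (toWord_injective.injOn)
  rintro _ ⟨g, hg, rfl⟩
  exact hg

lemma VI_finite (A : Subgroup (FreeGroup (Fin n))) (i : ℕ) : (pr A '' VI A i).Finite := by
  refine ((finite_norm_le (n := n) (i + 1)).image (pr A)).subset ?_
  rintro _ ⟨v, ⟨a, ha, h⟩, rfl⟩
  refine ⟨a⁻¹ * v, ?_, pr_act (A.inv_mem ha) v⟩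
  show FreeGroup.norm _ ≤ _
  omega

lemma GI_finite (A : Subgroup (FreeGroup (Fin n))) (i : ℕ) : (prE A '' GI A i).Finite := by
  refine ((VI_finite A i).prod (Set.finite_univ (α := Fin n))).subset ?_
  rintro _ ⟨e, he, rfl⟩
  exact ⟨⟨e.1, (GI_end e he).1, rfl⟩, trivial⟩

lemma rank_formula (H : Subgroup (FreeGroup (Fin n))) (i : ℕ) {B : Set (FreeGroup (Fin n))}
    (hBf : B.Finite) (hB : IsFreeBasis (HI H i) B) :
    (pr (HI H i) '' VI (HI H i) i).ncard + B.ncard = 1 + (prE (HI H i) '' GI (HI H i) i).ncard := by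
  have h1 := quasi_card_one GI_act VI_act GI_end one_mem_VI (VI_conn_one H i) (GI_finite (HI H i) i)
  have h2 := quasi_card_two hBf hB VI_act (VI_finite (HI H i) i)
  rw [h1] at h2
  exact (Nat.pow_right_injective le_rfl h2).symm

lemma HI_mono {H H' : Subgroup (FreeGroup (Fin n))} (h : H ≤ H') (i : ℕ) : HI H i ≤ HI H' i :=
  Subgroup.closure_mono fun _ hg => ⟨h hg.1, hg.2⟩

lemma HI_le (H : Subgroup (FreeGroup (Fin n))) (i : ℕ) : HI H i ≤ H :=
  (Subgroup.closure_le _).mpr fun _ hg => hg.1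

lemma GI_mono {A A' : Subgroup (FreeGroup (Fin n))} (h : A ≤ A') (i : ℕ) : GI A i ⊆ GI A' i :=
  fun _ ⟨a, ha, h'⟩ => ⟨a, h ha, h'⟩

/-- Elements of `H` identifying two edges of the graph already lie in `H_i`. -/
lemma mem_HI_of_act {H : Subgroup (FreeGroup (Fin n))} {i : ℕ} {e : Ed n} {h : FreeGroup (Fin n)}
    (hh : h ∈ H) (he : e ∈ GI (HI H i) i) (he' : act h e ∈ GI (HI H i) i) : h ∈ HI H i := by
  obtain ⟨a, ha, h1⟩ := he
  obtain ⟨b, hb, h2⟩ := he'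
  rw [tgt_act] at h2
  simp only [act] at h2
  have key : ∀ w, norm (b⁻¹ * h * a) ≤ norm (b⁻¹ * (h * w)) + norm (a⁻¹ * w) := by
    intro w
    have := norm_mul_le (b⁻¹ * (h * w)) (a⁻¹ * w)⁻¹
    rw [norm_inv_eq] at this
    rwa [show b⁻¹ * (h * w) * (a⁻¹ * w)⁻¹ = b⁻¹ * h * a by group] at this
  have k1 := key e.1
  have k2 := key (tgt e)
  have h3 : b⁻¹ * h * a ∈ HI H i := by
    apply Subgroup.subset_closure
    refine ⟨H.mul_mem (H.mul_mem (H.inv_mem (HI_le H i hb)) hh) (HI_le H i ha), by omega⟩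
  have h4 := (HI H i).mul_mem ((HI H i).mul_mem hb h3) ((HI H i).inv_mem ha)
  rwa [show b * (b⁻¹ * h * a) * a⁻¹ = h by group] at h4

variable [LinearOrder (Ed n)]

lemma ess_mono {G G' : Set (Ed n)} (h : G ⊆ G') : Ess G ⊆ Ess G' := by
  have hm : ∀ e u, Cl G e u ⊆ Cl G' e u := fun e u _ hv => 
    Conn.mono (S := Below G e) (S' := Below G' e) (fun _ hf => ⟨h hf.1, hf.2⟩) hv
  intro e he
  exact ⟨h he.1, he.2.1.mono (hm _ _), he.2.2.mono (hm _ _)⟩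

lemma ess_inter (H₁ H₂ : Subgroup (FreeGroup (Fin n))) (i : ℕ) :
    (prE (HI (H₁ ⊓ H₂) i) '' Ess (GI (HI (H₁ ⊓ H₂) i) i)).ncard ≤
      (prE (HI H₁ i) '' Ess (GI (HI H₁ i) i)).ncard *
      (prE (HI H₂ i) '' Ess (GI (HI H₂ i) i)).ncard := by
  choose! r hr using (fun q (hq : q ∈ prE (HI (H₁ ⊓ H₂) i) '' Ess (GI (HI (H₁ ⊓ H₂) i) i)) => hq)
  rw [← Set.ncard_prod]
  refine Set.ncard_le_ncard_of_injOn (fun q => (prE (HI H₁ i) (r q), prE (HI H₂ i) (r q))) ?_ ?_ ?_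
  · intro q hq
    have := (hr q hq).1
    exact ⟨⟨_, ess_mono (GI_mono (HI_mono inf_le_left i) i) this, rfl⟩,
      ⟨_, ess_mono (GI_mono (HI_mono inf_le_right i) i) this, rfl⟩⟩
  · intro q hq q' hq' hqq
    simp only [Prod.mk.injEq] at hqq
    obtain ⟨a, ha, hae⟩ := prE_eq.mp hqq.1
    obtain ⟨b, hb, hbe⟩ := prE_eq.mp hqq.2
    have hab : a = b := by
      have := congrArg Prod.fst (hae.symm.trans hbe)
      simpa [act] using this
    subst hab
    obtain ⟨h1, h2⟩ := hr q hq
    obtain ⟨h1', h2'⟩ := hr q' hq'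
    rw [← h2, ← h2']
    refine prE_eq.mpr ⟨a, mem_HI_of_act ⟨HI_le _ _ ha, HI_le _ _ hb⟩ h1.1 ?_, hae⟩
    rw [← hae]; exact h1'.1
  · exact ((GI_finite _ i).subset (Set.image_mono fun e he => he.1)).prod
      ((GI_finite _ i).subset (Set.image_mono fun e he => he.1))

lemma rank_le_ess (hord : ∀ (g : FreeGroup (Fin n)) (e f : Ed n), e < f → act g e < act g f)
    (H : Subgroup (FreeGroup (Fin n))) (i : ℕ) {B : Set (FreeGroup (Fin n))}
    (hBf : B.Finite) (hB : IsFreeBasis (HI H i) B) :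
    B.ncard ≤ 1 + (prE (HI H i) '' Ess (GI (HI H i) i)).ncard := by
  have h1 := rank_formula H i hBf hB
  have h2 := ncard_split hord (GI_act (A := HI H i) (i := i)) (GI_finite _ i)
  have h3 := ncard_ne_le hord (GI_act (A := HI H i) (i := i)) GI_end (VI_finite _ i)
  omega

lemma ess_le_rank (hord : ∀ (g : FreeGroup (Fin n)) (e f : Ed n), e < f → act g e < act g f)
    (H : Subgroup (FreeGroup (Fin n))) (i : ℕ) {B : Set (FreeGroup (Fin n))}
    (hBf : B.Finite) (hB : IsFreeBasis (HI H i) B) (hpos : 1 ≤ B.ncard) :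
    1 + (prE (HI H i) '' Ess (GI (HI H i) i)).ncard ≤ B.ncard := by
  have h1 := rank_formula H i hBf hB
  have h2 := ncard_split hord (GI_act (A := HI H i) (i := i)) (GI_finite _ i)
  have hinf : (VI (HI H i) i).Infinite := by
    have hsub : (HI H i : Set (FreeGroup (Fin n))) ⊆ VI (HI H i) i := 
      fun a ha => ⟨a, ha, by simp⟩
    refine Set.Infinite.mono hsub ?_
    obtain ⟨hBA, hbij⟩ := hB
    have : Nonempty B := by
      rw [Set.nonempty_coe_sort]
      apply Set.nonempty_of_ncard_ne_zero
      omega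
    have h3 : Infinite (HI H i) := Infinite.of_injective _ hbij.1
    exact Set.infinite_coe_iff.mp h3
  have h3 := ncard_ne_ge hord (GI_act (A := HI H i) (i := i)) hinf
    (fun u hu v hv => (VI_conn_one H i u hu).symm.trans (VI_conn_one H i v hv)) (GI_finite _ i)
  omega

end ball

end RG

namespace RG

lemma hanna {n : ℕ} [NeZero n] (H₁ H₂ : Subgroup (FreeGroup (Fin n))) (i : ℕ)
    {B B₁ B₂ : Set (FreeGroup (Fin n))} (hBf : B.Finite) (hB : IsFreeBasis (HI (H₁ ⊓ H₂) i) B)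
    (hBf₁ : B₁.Finite) (hB₁ : IsFreeBasis (HI H₁ i) B₁)
    (hBf₂ : B₂.Finite) (hB₂ : IsFreeBasis (HI H₂ i) B₂)
    (h1 : 1 ≤ B₁.ncard) (h2 : 1 ≤ B₂.ncard) :
    ∃ a b : ℕ, B₁.ncard = a + 1 ∧ B₂.ncard = b + 1 ∧ B.ncard ≤ 1 + a * b := by
  obtain ⟨o, hord⟩ := exists_order n
  letI := o
  have k0 := rank_le_ess hord (H₁ ⊓ H₂) i hBf hB
  have k1 := ess_le_rank hord H₁ i hBf₁ hB₁ h1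
  have k2 := ess_le_rank hord H₂ i hBf₂ hB₂ h2
  have k3 := ess_inter H₁ H₂ i
  refine ⟨B₁.ncard - 1, B₂.ncard - 1, by omega, by omega, ?_⟩
  refine k0.trans (Nat.add_le_add_left (k3.trans (Nat.mul_le_mul ?_ ?_)) 1) <;> omega

lemma rank_zero {n : ℕ} [NeZero n] {H H' : Subgroup (FreeGroup (Fin n))} (hle : H ≤ H') {i : ℕ}
    {B B' : Set (FreeGroup (Fin n))} (hBf : B.Finite) (hB : IsFreeBasis (HI H i) B)
    (hBf' : B'.Finite) (hB' : IsFreeBasis (HI H' i) B') (h0 : B'.ncard = 0) : B.ncard = 0 := by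
  rw [Set.ncard_eq_zero hBf'] at h0
  subst h0
  rw [Set.ncard_eq_zero hBf, Set.eq_empty_iff_forall_notMem]
  intro b hb
  obtain ⟨hBA', hbij'⟩ := hB'
  obtain ⟨hBA, hbij⟩ := hB
  have h1 : ∀ a ∈ HI H' i, a = 1 := by
    intro a ha
    obtain ⟨w, hw⟩ := hbij'.2 ⟨a, ha⟩
    have hw1 : w = 1 := Subsingleton.elim _ _
    rw [hw1, _root_.map_one] at hw
    exact (congrArg Subtype.val hw).symm
  have h2 : b = 1 := h1 b (HI_mono hle i (hBA b hb))
  have h3 : FreeGroup.of (⟨b, hb⟩ : B) = 1 := by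
    apply hbij.1
    rw [FreeGroup.lift_apply_of, _root_.map_one]
    exact Subtype.ext h2
  exact FreeGroup.of_ne_one _ h3

end RG

/-- Rank-growth of an intersection: for `H = H₁ ∩ H₂`,
`rk_H(i) ≤ 1 + 2(rk_{H₁}(i)−1)(rk_{H₂}(i)−1) − min(rk_{H₁}(i)−1, rk_{H₂}(i)−1)`
whenever `rk_{H₁}(i), rk_{H₂}(i) ≥ 1`; consequently `rk_H ≼ rk_{H₁}·rk_{H₂}`. -/
theorem rankGrowth_inter {n : ℕ} (hn : 1 ≤ n)
    (H₁ H₂ : Subgroup (FreeGroup (Fin n))) (h₁ : H₁ ≠ ⊥) (h₂ : H₂ ≠ ⊥)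
    (rk rk₁ rk₂ : ℕ → ℕ)
    (hrk : IsRankGrowth (H₁ ⊓ H₂) rk)
    (hrk₁ : IsRankGrowth H₁ rk₁) (hrk₂ : IsRankGrowth H₂ rk₂) :
    (∀ i : ℕ, 1 ≤ rk₁ i → 1 ≤ rk₂ i →
      (rk i : ℤ) ≤ 1 + 2 * ((rk₁ i : ℤ) - 1) * ((rk₂ i : ℤ) - 1) -
        min ((rk₁ i : ℤ) - 1) ((rk₂ i : ℤ) - 1)) ∧
    GrowthLe (fun i => (rk i : ℚ)) (fun i => (rk₁ i : ℚ) * (rk₂ i : ℚ)) := by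
  have : NeZero n := ⟨by omega⟩
  constructor
  · intro i hi1 hi2
    obtain ⟨B, hBf, hBc, hB⟩ := hrk i
    obtain ⟨B₁, hBf₁, hBc₁, hB₁⟩ := hrk₁ i
    obtain ⟨B₂, hBf₂, hBc₂, hB₂⟩ := hrk₂ i
    rw [← hBc₁] at hi1 ⊢
    rw [← hBc₂] at hi2 ⊢
    rw [← hBc]
    obtain ⟨a, b, ha, hb, hab⟩ := RG.hanna H₁ H₂ i hBf hB hBf₁ hB₁ hBf₂ hB₂ hi1 hi2
    rw [ha, hb]
    have hab' : (B.ncard : ℤ) ≤ 1 + a * b := by exact_mod_cast hab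
    have hm : min (a : ℤ) b ≤ a * b := by
      rcases Nat.eq_zero_or_pos a with h | h
      · subst h; simp
      · have h' : (1 : ℤ) ≤ a := by exact_mod_cast h
        exact (min_le_right _ _).trans (by nlinarith [Int.natCast_nonneg b])
    push_cast
    simp only [add_sub_cancel_right]
    linarith
  · refine ⟨1, le_rfl, fun i => ?_⟩
    simp only [Nat.cast_one, one_mul]
    obtain ⟨B, hBf, hBc, hB⟩ := hrk i
    obtain ⟨B₁, hBf₁, hBc₁, hB₁⟩ := hrk₁ i
    obtain ⟨B₂, hBf₂, hBc₂, hB₂⟩ := hrk₂ i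
    rw [← hBc, ← hBc₁, ← hBc₂]
    norm_cast
    rcases Nat.eq_zero_or_pos B₁.ncard with h | h
    · rw [RG.rank_zero inf_le_left hBf hB hBf₁ hB₁ h]; exact Nat.zero_le _
    rcases Nat.eq_zero_or_pos B₂.ncard with h' | h'
    · rw [RG.rank_zero inf_le_right hBf hB hBf₂ hB₂ h']; exact Nat.zero_le _
    obtain ⟨a, b, ha, hb, hab⟩ := RG.hanna H₁ H₂ i hBf hB hBf₁ hB₁ hBf₂ hB₂ h h'
    rw [ha, hb]
    nlinarith
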